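/- Let n be a natural number and let β₀ : Set.Icc (0:ℝ) 1 → (Fin n → ℂ) be a continuous map whose coordinate-multiset path has weakly decreasing shape: for all s ≤ t in Set.Icc (0:ℝ) 1, the shape of the coordinate multiset of β₀ s is a merge of the shape of the coordinate multiset of β₀ t. Fix x₀ : Fin n → ℂ whose multiset of coordinates equals that of β₀ 0. Then the set of continuous maps γ : Set.Icc (0:ℝ) 1 → (Fin n → ℂ) such that γ 0 = x₀ and, for every t, the multiset of coordinates of γ t equals the multiset of coordinates of β₀ t, is finite and has at most n! elements. -/

import Mathlib

/-- The shape of a finite multiset: the multiset of multiplicities of its distinct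
elements. -/
noncomputable def mshape {X : Type*} (M : Multiset X) : Multiset ℕ :=
  letI := Classical.decEq X
  Multiset.map (fun a => M.count a) M.toFinset.val

/-- `IsMergeOf μ lam` means `μ` is obtained from `lam` by grouping its entries and
replacing each (nonempty) group by its sum. -/
def IsMergeOf (μ lam : Multiset ℕ) : Prop :=
  ∃ m : Multiset (Multiset ℕ), (∀ s ∈ m, s ≠ 0) ∧ m.join = lam ∧
    Multiset.map Multiset.sum m = μ

theorem card_mshape {X : Type*} [DecidableEq X] (M : Multiset X) :
    (mshape M).card = M.toFinset.card := by
  simp only [mshape, Multiset.card_map, Finset.card_val]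
  congr!

theorem IsMergeOf.card_le {μ lam : Multiset ℕ} (h : IsMergeOf μ lam) : μ.card ≤ lam.card := by
  obtain ⟨m, hm, rfl, rfl⟩ := h
  rw [Multiset.card_map, Multiset.card_join]
  have hcard : ∀ k ∈ m.map Multiset.card, 1 ≤ k := by
    intro k hk
    obtain ⟨s, hs, rfl⟩ := Multiset.mem_map.1 hk
    exact Multiset.card_pos.2 (hm s hs)
  simpa using Multiset.card_nsmul_le_sum hcard

/-- Two enumerations with the same values agree if both are compatible with an enumeration `x`
that has at least as many distinct values. -/
theorem eq_of_multiset_map_eq_of_card_le {ι X : Type*} [Fintype ι] [DecidableEq X]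
    {f g x : ι → X}
    (hfg : Multiset.map f Finset.univ.val = Multiset.map g Finset.univ.val)
    (hcard : (Multiset.map g Finset.univ.val).toFinset.card ≤
      (Multiset.map x Finset.univ.val).toFinset.card)
    (hgg : ∀ i j, x i ≠ x j → g i ≠ g j) (hfg' : ∀ i j, x i ≠ x j → f i ≠ g j) : f = g := by
  have hinj : ∀ i j, x i = x j → g i = g j := by
    have hx : ∀ i, x i = Function.extend g x id (g i) := by
      intro i
      have hi : ∃ j, g j = g i := ⟨i, rfl⟩
      rw [Function.extend_def, dif_pos hi]
      by_contra hne
      exact hgg _ _ hne hi.choose_spec.symm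
    have himage : Finset.univ.image x = (Finset.univ.image g).image (Function.extend g x id) := by
      rw [Finset.image_image]
      exact Finset.image_congr fun i _ => hx i
    have hInjOn : Set.InjOn (Function.extend g x id) (Finset.univ.image g : Finset X) := by
      rw [← Finset.card_image_iff, ← himage]
      refine le_antisymm ?_ hcard
      rw [himage]
      exact Finset.card_image_le
    intro i j hij
    exact hInjOn (by simp) (by simp) (by rw [← hx, ← hx, hij])
  funext i
  have hi : f i ∈ Multiset.map g Finset.univ.val :=
    hfg ▸ Multiset.mem_map_of_mem f (Finset.mem_univ i)
  obtain ⟨j, -, hj⟩ := Multiset.mem_map.1 hi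
  have hxij : x i = x j := by
    by_contra hne
    exact hfg' i j hne hj.symm
  rw [← hj, hinj i j hxij]

/-- Lifts of a multiset path whose number of distinct values weakly increases are determined by
their endpoint. -/
theorem eq_of_lifts_of_apply_top_eq {T ι X : Type*} [LinearOrder T] [TopologicalSpace T]
    [OrderTopology T] [DenselyOrdered T] [CompactSpace T] [OrderTop T] [Fintype ι]
    [TopologicalSpace X] [T2Space X] [DecidableEq X] {M : T → Multiset X}
    (hM : Monotone fun t => (M t).toFinset.card) {γ δ : T → ι → X}
    (hγ : Continuous γ) (hδ : Continuous δ)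
    (hγM : ∀ t, Multiset.map (γ t) Finset.univ.val = M t)
    (hδM : ∀ t, Multiset.map (δ t) Finset.univ.val = M t) (htop : γ ⊤ = δ ⊤) : γ = δ := by
  funext s
  have hclosed : IsClosed ({t | γ t = δ t} ∩ Set.Ici s) :=
    (isClosed_eq hγ hδ).inter isClosed_Ici
  obtain ⟨t, ⟨ht, hst⟩, hmin⟩ := hclosed.isCompact.exists_isLeast ⟨⊤, htop, le_top⟩
  rcases (show s ≤ t from hst).eq_or_lt with rfl | hlt
  · exact ht
  have hγ' : ∀ i, Continuous fun r => γ r i := fun i => (continuous_apply i).comp hγ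
  have hδ' : ∀ i, Continuous fun r => δ r i := fun i => (continuous_apply i).comp hδ
  have hev : ∀ᶠ r in nhds t, ∀ i j, δ t i ≠ δ t j → δ r i ≠ δ r j ∧ γ r i ≠ δ r j := by
    refine Filter.eventually_all.2 fun i => Filter.eventually_all.2 fun j => ?_
    by_cases hij : δ t i = δ t j
    · exact Filter.Eventually.of_forall fun r hne => absurd hij hne
    have hij' : γ t i ≠ δ t j := by rwa [show γ t = δ t from ht]
    have hopen₁ := isOpen_ne_fun (hδ' i) (hδ' j)
    have hopen₂ := isOpen_ne_fun (hγ' i) (hδ' j)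
    filter_upwards [hopen₁.mem_nhds hij, hopen₂.mem_nhds hij'] with r h₁ h₂ _
    exact ⟨h₁, h₂⟩
  have : (nhdsWithin t (Set.Iio t)).NeBot := nhdsLT_neBot_of_exists_lt ⟨s, hlt⟩
  obtain ⟨r, hr, hrs, hrt⟩ := ((hev.filter_mono nhdsWithin_le_nhds).and
    (Ioo_mem_nhdsLT hlt)).exists
  have hrmem : γ r = δ r :=
    eq_of_multiset_map_eq_of_card_le ((hγM r).trans (hδM r).symm)
      (by rw [hδM, hδM]; exact hM hrt.le)
      (fun i j hij => (hr i j hij).1) (fun i j hij => (hr i j hij).2)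
  exact absurd (hmin ⟨hrmem, hrs.le⟩) hrt.not_ge

/-- A multiset path with weakly decreasing shape has at most `n!` lifts through the
`Mult` map with a given start point. -/
theorem stmt_8 (n : ℕ) (β₀ : Set.Icc (0:ℝ) 1 → (Fin n → ℂ)) (h₀ : Continuous β₀)
    (hdec : ∀ s t : Set.Icc (0:ℝ) 1, s ≤ t →
      IsMergeOf (mshape (Multiset.map (β₀ s) Finset.univ.val))
        (mshape (Multiset.map (β₀ t) Finset.univ.val)))
    (x₀ : Fin n → ℂ)
    (hx₀ : Multiset.map x₀ Finset.univ.val =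
      Multiset.map (β₀ ⟨0, by norm_num⟩) Finset.univ.val) :
    {γ : Set.Icc (0:ℝ) 1 → (Fin n → ℂ) | Continuous γ ∧ γ ⟨0, by norm_num⟩ = x₀ ∧
        ∀ t, Multiset.map (γ t) Finset.univ.val =
          Multiset.map (β₀ t) Finset.univ.val}.Finite ∧
      {γ : Set.Icc (0:ℝ) 1 → (Fin n → ℂ) | Continuous γ ∧ γ ⟨0, by norm_num⟩ = x₀ ∧
        ∀ t, Multiset.map (γ t) Finset.univ.val =
          Multiset.map (β₀ t) Finset.univ.val}.ncard ≤ n.factorial := by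
  classical
  have hM : Monotone fun t => (Multiset.map (β₀ t) Finset.univ.val).toFinset.card := by
    intro s t hst
    simpa only [card_mshape] using (hdec s t hst).card_le
  set S := {γ : Set.Icc (0:ℝ) 1 → (Fin n → ℂ) | Continuous γ ∧ γ ⟨0, by norm_num⟩ = x₀ ∧
    ∀ t, Multiset.map (γ t) Finset.univ.val = Multiset.map (β₀ t) Finset.univ.val}
  set P : Finset (List ℂ) := (List.ofFn (β₀ ⊤)).permutations.toFinset with hP
  have hmaps : Set.MapsTo (fun γ : Set.Icc (0:ℝ) 1 → (Fin n → ℂ) => List.ofFn (γ ⊤)) S P := by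
    intro γ hγ
    have hperm := hγ.2.2 ⊤
    rw [Fin.univ_val_map, Fin.univ_val_map, Multiset.coe_eq_coe] at hperm
    simpa [hP] using hperm
  have hinj : Set.InjOn (fun γ : Set.Icc (0:ℝ) 1 → (Fin n → ℂ) => List.ofFn (γ ⊤)) S :=
    fun γ hγ δ hδ h => eq_of_lifts_of_apply_top_eq hM hγ.1 hδ.1 hγ.2.2 hδ.2.2
      (List.ofFn_injective h)
  have hcard : P.card ≤ n.factorial := by
    simpa [hP, List.length_permutations] using
      List.toFinset_card_le (List.ofFn (β₀ ⊤)).permutations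
  refine ⟨Set.Finite.of_injOn hmaps hinj P.finite_toSet, le_trans ?_ hcard⟩
  rw [← Set.ncard_coe_finset]
  exact Set.ncard_le_ncard_of_injOn _ hmaps hinj P.finite_toSet
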